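/- If T ∈ MCS(S,A), then the set Arg_seq(S,T) of all assumptive sequent arguments whose assumptions are contained in T and whose supports are contained in S is conflict-free in the sequent-based ABA-framework. -/

import Mathlib

/-- A rule `φ₁,…,φₙ → φ` of a deductive system: premises and a conclusion. -/
abbrev Rule (F : Type) := List F × F

/-- Deducibility `Γ ⊢^R φ`: chaining rules of `R` from members of `Γ`. -/
inductive Ded {F : Type} (R : Set (Rule F)) (Γ : Set F) : F → Prop
  | mem {φ : F} : φ ∈ Γ → Ded R Γ φ
  | app {l : List F} {φ : F} : (l, φ) ∈ R → (∀ ψ ∈ l, Ded R Γ ψ) → Ded R Γ φ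

/-- Derivability of assumptive sequents `A' ⟨ Γ ⇒ Δ` in the calculus `R_⇒`:
the sequents `μ(r)` for `r ∈ R`, the identity axiom, the two cut rules, and the
rules `AS_ABA` moving a formula of the assumption set `AS` between the
assumption component and the left-hand side of `⇒`. -/
inductive SeqDer {F : Type} [DecidableEq F] (R : Set (Rule F)) (AS : Set F) :
    Finset F → Finset F → Finset F → Prop
  | id (φ : F) : SeqDer R AS ∅ {φ} {φ}
  | mu {l : List F} {φ : F} : (l, φ) ∈ R → SeqDer R AS ∅ l.toFinset {φ}
  | cutLhs {A₁ A₂ Γ₁ Γ₂ Δ₁ Δ₂ : Finset F} {φ : F} :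
      SeqDer R AS A₁ Γ₁ (insert φ Δ₁) → SeqDer R AS A₂ (insert φ Γ₂) Δ₂ →
      SeqDer R AS (A₁ ∪ A₂) (Γ₁ ∪ Γ₂) (Δ₁ ∪ Δ₂)
  | cutAss {A₁ A₂ Γ₁ Γ₂ Δ₁ Δ₂ : Finset F} {φ : F} :
      SeqDer R AS A₁ Γ₁ (insert φ Δ₁) → SeqDer R AS (insert φ A₂) Γ₂ Δ₂ →
      SeqDer R AS (A₁ ∪ A₂) (Γ₁ ∪ Γ₂) (Δ₁ ∪ Δ₂)
  | toAss {A' Γ Δ : Finset F} {φ : F} :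
      φ ∈ AS → SeqDer R AS A' (insert φ Γ) Δ → SeqDer R AS (insert φ A') Γ Δ
  | toLhs {A' Γ Δ : Finset F} {φ : F} :
      φ ∈ AS → SeqDer R AS (insert φ A') Γ Δ → SeqDer R AS A' (insert φ Γ) Δ

/-- An argument: an assumption component, a support (strict premises) and a conclusion. -/
structure Argu (F : Type) where
  ass : Finset F
  supp : Finset F
  concl : F

/-- `a` is an ABA-argument based on `S` and `A`: a deduction `ass(a) ∪ supp(a) ⊢^R conc(a)`
with finite `ass(a) ⊆ A` and finite `supp(a) ⊆ S`. -/
def IsABAArg {F : Type} (R : Set (Rule F)) (S A : Set F) (a : Argu F) : Prop :=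
  ↑a.ass ⊆ A ∧ ↑a.supp ⊆ S ∧ Ded R (↑a.ass ∪ ↑a.supp) a.concl

/-- `a` is an assumptive sequent argument based on `S` and `A`: a sequent
`ass(a) ⟨ supp(a) ⇒ conc(a)` derivable in `R_⇒`, with `ass(a) ⊆ A` and `supp(a) ⊆ S`. -/
def IsSeqArg {F : Type} [DecidableEq F] (R : Set (Rule F)) (S A : Set F) (a : Argu F) : Prop :=
  ↑a.ass ⊆ A ∧ ↑a.supp ⊆ S ∧ SeqDer R A a.ass a.supp {a.concl}

/-- `a` attacks `b` iff the conclusion of `a` is the contrary of some assumption of `b`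
(this is the ABA attack, and also the sequent-based `AT_ABA` attack). -/
def Attacks {F : Type} (contrary : F → F) (a b : Argu F) : Prop :=
  ∃ ψ ∈ b.ass, a.concl = contrary ψ

/-- `E` is conflict-free: a set of arguments of the framework no member of which attacks a member. -/
def ConflictFree {α : Type} (Args : Set α) (att : α → α → Prop) (E : Set α) : Prop :=
  E ⊆ Args ∧ ∀ a ∈ E, ∀ b ∈ E, ¬ att a b

/-- `E` defends `a`: `E` attacks every attacker of `a`. -/
def Defends {α : Type} (Args : Set α) (att : α → α → Prop) (E : Set α) (a : α) : Prop :=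
  ∀ b ∈ Args, att b a → ∃ c ∈ E, att c b

/-- `E` is admissible: conflict-free and defending all of its elements. -/
def Admissible {α : Type} (Args : Set α) (att : α → α → Prop) (E : Set α) : Prop :=
  ConflictFree Args att E ∧ ∀ a ∈ E, Defends Args att E a

/-- A complete extension: an admissible set containing every argument it defends. -/
def CompleteExt {α : Type} (Args : Set α) (att : α → α → Prop) (E : Set α) : Prop :=
  Admissible Args att E ∧ ∀ a ∈ Args, Defends Args att E a → a ∈ E

/-- The grounded extension: the ⊆-minimal complete extension. -/
def GroundedExt {α : Type} (Args : Set α) (att : α → α → Prop) (E : Set α) : Prop :=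
  CompleteExt Args att E ∧ ∀ E', CompleteExt Args att E' → E ⊆ E'

/-- A preferred extension: a ⊆-maximal complete extension. -/
def PreferredExt {α : Type} (Args : Set α) (att : α → α → Prop) (E : Set α) : Prop :=
  CompleteExt Args att E ∧ ∀ E', CompleteExt Args att E' → E ⊆ E' → E' = E

/-- A set `A'` of assumptions is consistent iff there is no `φ ∈ A'` with
`A'' ∪ Γ ⊢^R φ̄` for some `A'' ⊆ A'` and `Γ ⊆ S`. -/
def ConsistentSet {F : Type} (R : Set (Rule F)) (contrary : F → F) (S : Set F)
    (A' : Set F) : Prop :=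
  ¬ ∃ φ ∈ A', ∃ A'' ⊆ A', ∃ Γ ⊆ S, Ded R (A'' ∪ Γ) (contrary φ)

/-- `MCS(S,A)`: the set of ⊆-maximal consistent subsets of `A`. -/
def MCS {F : Type} (R : Set (Rule F)) (contrary : F → F) (S A : Set F) : Set (Set F) :=
  {T | T ⊆ A ∧ ConsistentSet R contrary S T ∧
    ∀ T', T ⊆ T' → T' ⊆ A → ConsistentSet R contrary S T' → T' = T}

/-- `CN(T) = {φ | Γ ⊢^R φ for some Γ ⊆ T}`. -/
def CN {F : Type} (R : Set (Rule F)) (T : Set F) : Set F :=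
  {φ | ∃ Γ ⊆ T, Ded R Γ φ}

/-- `⊢^R` is contrapositive for assumptions: for all `φ, ψ` in an assumption set `A'`
and `Γ ⊆ S`, `A' ∪ Γ ⊢^R ψ̄` iff `(A' \ {φ}) ∪ {ψ} ∪ Γ ⊢^R φ̄`. -/
def Contrapositive {F : Type} (R : Set (Rule F)) (contrary : F → F) (S A : Set F) : Prop :=
  ∀ A' ⊆ A, ∀ Γ ⊆ S, ∀ φ ∈ A', ∀ ψ ∈ A',
    (Ded R (A' ∪ Γ) (contrary ψ) ↔ Ded R ((A' \ {φ}) ∪ {ψ} ∪ Γ) (contrary φ))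

/-- Deducibility is closed under replacing premises by deductions of them. -/
theorem Ded.subst {F : Type} {R : Set (Rule F)} {Γ Γ' : Set F} {φ : F}
    (h : Ded R Γ φ) (hΓ : ∀ ψ ∈ Γ, Ded R Γ' ψ) : Ded R Γ' φ := by
  induction h with
  | mem h => exact hΓ _ h
  | app hr _ ih => exact .app hr ih

theorem Ded.mono {F : Type} {R : Set (Rule F)} {Γ Γ' : Set F} {φ : F}
    (h : Ded R Γ φ) (hΓ : Γ ⊆ Γ') : Ded R Γ' φ :=
  h.subst fun _ hψ => .mem (hΓ hψ)

/-- Soundness of cut for deducibility of some member of the succedent. -/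
theorem Ded.exists_cut {F : Type} [DecidableEq F] {R : Set (Rule F)} {Θ₁ Θ₂ Θ : Set F}
    {Δ₁ Δ₂ : Finset F} {φ : F} (h₁ : ∃ δ ∈ insert φ Δ₁, Ded R Θ₁ δ)
    (h₂ : ∃ δ ∈ Δ₂, Ded R Θ₂ δ) (hΘ₁ : Θ₁ ⊆ Θ) (hΘ₂ : Θ₂ ⊆ insert φ Θ) :
    ∃ δ ∈ Δ₁ ∪ Δ₂, Ded R Θ δ := by
  obtain ⟨δ₁, hδ₁, hd₁⟩ := h₁
  obtain ⟨δ₂, hδ₂, hd₂⟩ := h₂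
  rcases Finset.mem_insert.1 hδ₁ with rfl | hδ₁
  · refine ⟨δ₂, Finset.mem_union_right _ hδ₂, hd₂.subst fun ψ hψ => ?_⟩
    rcases hΘ₂ hψ with rfl | hψ
    · exact hd₁.mono hΘ₁
    · exact .mem hψ
  · exact ⟨δ₁, Finset.mem_union_left _ hδ₁, hd₁.mono hΘ₁⟩

/-- A derivable sequent has a member of its succedent that is deducible from its
assumptions and left-hand side. -/
theorem SeqDer.exists_ded {F : Type} [DecidableEq F] {R : Set (Rule F)} {AS : Set F}
    {A' Γ Δ : Finset F} (h : SeqDer R AS A' Γ Δ) :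
    ∃ δ ∈ Δ, Ded R ((A' : Set F) ∪ (Γ : Set F)) δ := by
  induction h with
  | id φ => exact ⟨φ, by simp, .mem (by simp)⟩
  | @mu l φ hr => exact ⟨φ, by simp, .app hr fun ψ hψ => .mem (by simpa using hψ)⟩
  | cutLhs _ _ ih₁ ih₂ =>
    refine Ded.exists_cut ih₁ ih₂ ?_ ?_ <;> intro x <;> simp <;> tauto
  | cutAss _ _ ih₁ ih₂ =>
    refine Ded.exists_cut ih₁ ih₂ ?_ ?_ <;> intro x <;> simp <;> tauto
  | toAss _ _ ih =>
    simpa only [Finset.coe_insert, Set.insert_union, Set.union_insert] using ih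
  | toLhs _ _ ih =>
    simpa only [Finset.coe_insert, Set.insert_union, Set.union_insert] using ih

/-- If `T ∈ MCS(S,A)` then `Arg_seq(S,T)`, the set of all assumptive sequent arguments
whose assumptions are contained in `T` and whose supports are contained in `S`, is
conflict-free in the sequent-based ABA-framework. -/
theorem stmt8 {F V : Type} [DecidableEq F]
    (R : Set (Rule F)) (S A : Set F) (contrary : F → F) (atoms : F → Set V)
    (hA : A.Nonempty) (hSA : S ∩ A = ∅)
    (hNT : ∀ φ : F, (∀ s ∈ S, Disjoint (atoms φ) (atoms s)) → ¬ Ded R S φ)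
    (T : Set F) (hT : T ∈ MCS R contrary S A) :
    ConflictFree {a | IsSeqArg R S A a} (Attacks contrary)
      {a | IsSeqArg R S A a ∧ (a.ass : Set F) ⊆ T} := by
  refine ⟨fun a ha => ha.1, ?_⟩
  rintro a ⟨⟨_, hS, hder⟩, haT⟩ b ⟨_, hbT⟩ ⟨ψ, hψ, hc⟩
  obtain ⟨δ, hδ, hded⟩ := hder.exists_ded
  rw [Finset.mem_singleton.1 hδ, hc] at hded
  exact hT.2.1 ⟨ψ, hbT hψ, a.ass, haT, a.supp, hS, hded⟩
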